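/- For every s > 0 and every ε > 0 there exists a constant C = C(s,ε) > 0 such that for all trigonometric polynomials u, v : S¹ → ℝ, writing g(x) := ∫_{S¹}(u(x)−u(y))(v(x)−v(y))/|x−y|² dy (i.e. g = d_{1/2}u·d_{1/2}v), one has: Σ_{n∈ℤ} |n|^{2s} |ĝ(n)|² ≤ C [ (Σ_{j∈ℤ}|j|^{1+2s+8ε}|û(j)|²)(Σ_{j∈ℤ}|j|^{2−4ε}|v̂(j)|²) + (Σ_{j∈ℤ}|j|^{2−4ε}|û(j)|²)(Σ_{j∈ℤ}|j|^{1+2s+8ε}|v̂(j)|²) ]. (This is the estimate ‖d_{1/2}u·d_{1/2}v‖_{Ḣ^s} ≲ ‖(−Δ)^{1/4+s/2+2ε}u‖_{L²}‖(−Δ)^{1/2−ε}v‖_{L²} + ‖(−Δ)^{1/2−ε}u‖_{L²}‖(−Δ)^{1/4+s/2+2ε}v‖_{L²}.) -/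

import Mathlib

open MeasureTheory Real Filter
open scoped BigOperators ENNReal Real Topology

noncomputable section

/-- Chord distance on `S¹ ≃ ℝ/2πℤ`: `|x-y| = 2|sin((x-y)/2)|`. -/
def cd (x y : ℝ) : ℝ := 2 * |Real.sin ((x - y) / 2)|

/-- Fundamental domain for the circle `S¹ ≃ ℝ/2πℤ`. -/
def circ : Set ℝ := Set.Ioc (-π) π

/-- `k`-th Fourier coefficient of a `2π`-periodic function `ℝ → ℂ`. -/
def fc (f : ℝ → ℂ) (k : ℤ) : ℂ :=
  ((1 / (2 * π) : ℝ) : ℂ) * ∫ x in circ, f x * Complex.exp (-(Complex.I * (k : ℂ) * (x : ℂ)))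

/-- Fourier coefficient of a real-valued function. -/
def fcR (f : ℝ → ℝ) (k : ℤ) : ℂ := fc (fun x => (f x : ℂ)) k

/-- `ℝⁿ` as a Euclidean space. -/
abbrev E (n : ℕ) := EuclideanSpace ℝ (Fin n)

/-- Componentwise Fourier coefficients of a vector-valued map. -/
def fcV {n : ℕ} (u : ℝ → E n) (k : ℤ) (i : Fin n) : ℂ := fcR (fun x => u x i) k

/-- Squared homogeneous `Ḣ^{1/2}` seminorm: `∑_k |k| |û(k)|²` (valued in `[0,∞]`). -/
def hHalf {n : ℕ} (u : ℝ → E n) : ℝ≥0∞ :=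
  ∑' k : ℤ, (k.natAbs : ℝ≥0∞) * ∑ i, (‖fcV u k i‖₊ : ℝ≥0∞) ^ 2

/-- Squared inhomogeneous `H^s` norm: `∑_k (1+k²)^s |û(k)|²` (valued in `[0,∞]`). -/
def hSob {n : ℕ} (s : ℝ) (u : ℝ → E n) : ℝ≥0∞ :=
  ∑' k : ℤ, ENNReal.ofReal ((1 + (k : ℝ) ^ 2) ^ s) * ∑ i, (‖fcV u k i‖₊ : ℝ≥0∞) ^ 2

/-- Squared homogeneous `Ḣ^{1/2}` seminorm of a scalar function. -/
def hHalfR (f : ℝ → ℝ) : ℝ≥0∞ :=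
  ∑' k : ℤ, (k.natAbs : ℝ≥0∞) * (‖fcR f k‖₊ : ℝ≥0∞) ^ 2

/-- Squared inhomogeneous `H^s` norm of a scalar function. -/
def hSobR (s : ℝ) (f : ℝ → ℝ) : ℝ≥0∞ :=
  ∑' k : ℤ, ENNReal.ofReal ((1 + (k : ℝ) ^ 2) ^ s) * (‖fcR f k‖₊ : ℝ≥0∞) ^ 2

/-- `|d_{1/2}u|²(x) = ∫_{S¹} |u(x)-u(y)|²/|x-y|² dy`. -/
def gagl {n : ℕ} (u : ℝ → E n) (x : ℝ) : ℝ :=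
  ∫ y in circ, (∑ i, (u x i - u y i) ^ 2) / cd x y ^ 2

/-- `∫_{S¹}∫_{S¹} d_{1/2}u(x,y)·d_{1/2}φ(x,y) dy dx/|x-y|`. -/
def pairing {n : ℕ} (u φ : ℝ → E n) : ℝ :=
  ∫ x in circ, ∫ y in circ, (∑ i, (u x i - u y i) * (φ x i - φ y i)) / cd x y ^ 2

/-- The product measure on `(0,∞) × S¹`. -/
def STmeasure : Measure (ℝ × ℝ) :=
  (volume.restrict (Set.Ioi (0 : ℝ))).prod (volume.restrict circ)

/-- Smooth test functions on `(0,∞) × S¹`, compactly supported in time. -/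
structure IsSTTest (n : ℕ) (φ : ℝ → ℝ → E n) : Prop where
  smooth : ContDiff ℝ (⊤ : ℕ∞) (fun p : ℝ × ℝ => φ p.1 p.2)
  periodic : ∀ t, Function.Periodic (φ t) (2 * π)
  suppTime : ∃ a b : ℝ, 0 < a ∧ ∀ t, t ∉ Set.Icc a b → ∀ x, φ t x = 0

/-- Energy-class solution of the half-harmonic gradient flow, with explicit
weak time derivative `w`. -/
structure IsEnergySolAux (n : ℕ) (u₀ : ℝ → E n) (u w : ℝ → ℝ → E n) : Prop where
  meas : Measurable (Function.uncurry u)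
  periodic : ∀ t, Function.Periodic (u t) (2 * π)
  sphere : ∀ᵐ p ∂STmeasure, ‖u p.1 p.2‖ = 1
  energyBdd : ∃ M : ℝ≥0∞, M < ⊤ ∧
    ∀ᵐ t ∂(volume.restrict (Set.Ioi (0 : ℝ))), hHalf (u t) ≤ M
  wMeas : Measurable (Function.uncurry w)
  wL2 : (∫⁻ t in Set.Ioi (0 : ℝ), ∫⁻ x in circ, (‖w t x‖₊ : ℝ≥0∞) ^ 2) < ⊤
  weakDeriv : ∀ φ : ℝ → ℝ → E n, IsSTTest n φ →
    (∫ t in Set.Ioi (0 : ℝ), ∫ x in circ, ∑ i, u t x i * deriv (fun s => φ s x i) t)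
      = - ∫ t in Set.Ioi (0 : ℝ), ∫ x in circ, ∑ i, w t x i * φ t x i
  flow : ∀ φ : ℝ → ℝ → E n, IsSTTest n φ →
    (∫ t in Set.Ioi (0 : ℝ), ∫ x in circ, ∑ i, w t x i * φ t x i)
      + (∫ t in Set.Ioi (0 : ℝ), pairing (u t) (φ t))
      = ∫ t in Set.Ioi (0 : ℝ), ∫ x in circ, gagl (u t) x * ∑ i, u t x i * φ t x i
  init : Tendsto (fun t => ∫⁻ x in circ, (‖u t x - u₀ x‖₊ : ℝ≥0∞) ^ 2)
      (nhdsWithin 0 (Set.Ioi 0)) (nhds 0)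

/-- Energy-class solution of the half-harmonic gradient flow. -/
def IsEnergySol (n : ℕ) (u₀ : ℝ → E n) (u : ℝ → ℝ → E n) : Prop :=
  ∃ w, IsEnergySolAux n u₀ u w

/-- Energy decay: `‖u(t,·)‖_{Ḣ^{1/2}} ≤ ‖u₀‖_{Ḣ^{1/2}}` for a.e. `t ≥ 0`. -/
def EnergyDecay {n : ℕ} (u₀ : ℝ → E n) (u : ℝ → ℝ → E n) : Prop :=
  ∀ᵐ t ∂(volume.restrict (Set.Ioi (0 : ℝ))), hHalf (u t) ≤ hHalf u₀

/-- Fractional Laplacian `(-Δ)^s` of a `2π`-periodic function, via Fourier series. -/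
def fracLapC (s : ℝ) (f : ℝ → ℂ) (x : ℝ) : ℂ :=
  ∑' k : ℤ, (((k.natAbs : ℝ) ^ s : ℝ) : ℂ) * fc f k * Complex.exp (Complex.I * (k : ℂ) * (x : ℂ))

/-- Fractional Laplacian of a real-valued function. -/
def fracLapR (s : ℝ) (f : ℝ → ℝ) (x : ℝ) : ℝ := (fracLapC s (fun y => (f y : ℂ)) x).re

/-- Half-Laplacian of a vector-valued map. -/
def halfLap {n : ℕ} (u : ℝ → E n) (x : ℝ) : E n :=
  (EuclideanSpace.equiv (Fin n) ℝ).symm fun i => fracLapR 1 (fun y => u y i) x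

/-- The integral `C(j,k) = ∫_{-π}^{π} (e^{ijh}-1)(e^{ikh}-1)/(4sin²(h/2)) dh`. -/
def Cjk (j k : ℤ) : ℂ :=
  ∫ h in circ, (Complex.exp (Complex.I * (j : ℂ) * (h : ℂ)) - 1)
      * (Complex.exp (Complex.I * (k : ℂ) * (h : ℂ)) - 1)
      / ((4 * Real.sin (h / 2) ^ 2 : ℝ) : ℂ)

/-- A real trigonometric polynomial: the function equals a finite Fourier sum. -/
def IsTrigPoly (u : ℝ → ℝ) : Prop :=
  ∃ s : Finset ℤ, ∀ x : ℝ,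
    (u x : ℂ) = ∑ k ∈ s, fcR u k * Complex.exp (Complex.I * (k : ℂ) * (x : ℂ))

/-- `d_{1/2}u · d_{1/2}v` as a (complex-valued) function on the circle. -/
def d12prod (u v : ℝ → ℝ) (x : ℝ) : ℂ :=
  ((∫ y in circ, (u x - u y) * (v x - v y) / cd x y ^ 2 : ℝ) : ℂ)

/-- Stereographic projection of `S¹ ∖ {-i}`. -/
def stproj (θ : ℝ) : ℝ := Real.cos θ / (1 + Real.sin θ)


/-- The character `x ↦ e^{imx}` of the circle. -/
def expI (m : ℤ) (x : ℝ) : ℂ := Complex.exp (Complex.I * (m : ℂ) * (x : ℂ))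

lemma expI_add (m n : ℤ) (x : ℝ) : expI (m + n) x = expI m x * expI n x := by
  simp only [expI, ← Complex.exp_add]
  push_cast
  ring_nf

lemma expI_add_right (m : ℤ) (x y : ℝ) : expI m (x + y) = expI m x * expI m y := by
  simp only [expI, ← Complex.exp_add]
  push_cast
  ring_nf

lemma expI_zero (x : ℝ) : expI 0 x = 1 := by simp [expI]

lemma expI_nat (a : ℕ) (x : ℝ) : expI a x = expI 1 x ^ a := by
  simp only [expI, ← Complex.exp_nat_mul]
  push_cast
  ring_nf

lemma expI_neg_nat (a : ℕ) (x : ℝ) : expI (-a) x = expI (-1) x ^ a := by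
  simp only [expI, ← Complex.exp_nat_mul]
  push_cast
  ring_nf

@[fun_prop]
lemma continuous_expI (m : ℤ) : Continuous (expI m) := by
  unfold expI
  fun_prop

lemma expI_periodic (m : ℤ) : Function.Periodic (expI m) (2 * π) := by
  intro x
  rw [expI_add_right]
  have : expI m (2 * π) = 1 := by
    rw [expI, Complex.exp_eq_one_iff]
    exact ⟨m, by push_cast; ring⟩
  rw [this, mul_one]

lemma integrableOn_circ {f : ℝ → ℂ} (hf : Continuous f) : IntegrableOn f circ :=
  (hf.integrableOn_Icc (a := -π) (b := π)).mono_set Set.Ioc_subset_Icc_self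

lemma integral_expI (m : ℤ) : ∫ x in circ, expI m x = if m = 0 then 2 * (π : ℂ) else 0 := by
  split_ifs with h
  · subst h
    simp only [expI_zero]
    rw [circ, setIntegral_const]
    simp [Measure.real, Real.volume_Ioc]
    rw [ENNReal.toReal_ofReal (by positivity)]
    push_cast
    ring
  · rw [circ, ← intervalIntegral.integral_of_le (by linarith [pi_pos])]
    unfold expI
    have hc : Complex.I * (m : ℂ) ≠ 0 := by simp [h]
    rw [integral_exp_mul_complex hc]
    have := expI_periodic m (-π)
    rw [show -π + 2 * π = π by ring] at this
    unfold expI at this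
    rw [this, sub_self, zero_div]

lemma expI_one_mul_expI_neg_one (x : ℝ) : expI 1 x * expI (-1) x = 1 := by
  rw [← expI_add]
  simp [expI_zero]

lemma expI_one_sub_one_mul (x : ℝ) :
    (expI 1 x - 1) * (expI (-1) x - 1) = ((4 * Real.sin (x / 2) ^ 2 : ℝ) : ℂ) := by
  have h1 : expI 1 x = Complex.cos x + Complex.sin x * Complex.I := by
    rw [expI, ← Complex.exp_mul_I]
    push_cast
    ring_nf
  have h2 : expI (-1) x = Complex.cos x - Complex.sin x * Complex.I := by
    have : expI (-1) x = Complex.exp ((-x : ℂ) * Complex.I) := by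
      rw [expI]
      push_cast
      ring_nf
    rw [this, Complex.exp_mul_I, Complex.cos_neg, Complex.sin_neg]
    ring
  have h3 : Real.sin (x / 2) ^ 2 = 1 / 2 - Real.cos x / 2 := by
    rw [Real.sin_sq_eq_half_sub]
    ring_nf
  rw [h3, h1, h2]
  push_cast
  linear_combination (Complex.sin x) ^ 2 * (-Complex.I_sq) + Complex.sin_sq_add_cos_sq (x : ℂ)

lemma sin_half_ne_zero {x : ℝ} (hx : x ∈ circ) (h0 : x ≠ 0) : Real.sin (x / 2) ≠ 0 := by
  intro h
  have := (Real.sin_eq_zero_iff_of_lt_of_lt (x := x / 2) (by linarith [hx.1, pi_pos])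
    (by linarith [hx.2, pi_pos])).1 h
  exact h0 (by linarith)

/-- The integrand defining `Cjk`. -/
def kernelC (j k : ℤ) (h : ℝ) : ℂ :=
  (expI j h - 1) * (expI k h - 1) / ((4 * Real.sin (h / 2) ^ 2 : ℝ) : ℂ)

lemma kernelC_ae_eq {j k : ℤ} {f : ℝ → ℂ}
    (hf : ∀ h, (expI j h - 1) * (expI k h - 1) = (expI 1 h - 1) * (expI (-1) h - 1) * f h) :
    kernelC j k =ᵐ[volume.restrict circ] f := by
  have h0 : ∀ᵐ x ∂(volume.restrict circ), x ≠ (0 : ℝ) := Measure.ae_ne _ _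
  filter_upwards [h0, ae_restrict_mem measurableSet_Ioc] with x hx0 hx
  have hs := sin_half_ne_zero hx hx0
  have hne : ((4 * Real.sin (x / 2) ^ 2 : ℝ) : ℂ) ≠ 0 := by
    rw [Complex.ofReal_ne_zero]
    positivity
  rw [kernelC, hf, expI_one_sub_one_mul, mul_div_cancel_left₀ _ hne]

lemma kernelC_nat_nat (a b : ℕ) :
    kernelC a b =ᵐ[volume.restrict circ]
      fun h => -∑ p ∈ Finset.range a, ∑ q ∈ Finset.range b, expI ((p : ℤ) + q + 1) h := by
  refine kernelC_ae_eq fun h => ?_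
  simp only [expI_add, expI_nat, ← Finset.mul_sum, ← Finset.sum_mul]
  rw [← geom_sum_mul (expI 1 h) a, ← geom_sum_mul (expI 1 h) b]
  linear_combination (∑ i ∈ Finset.range a, expI 1 h ^ i) * (∑ i ∈ Finset.range b, expI 1 h ^ i) *
    (expI 1 h - 1) * (expI_one_mul_expI_neg_one h)

lemma kernelC_neg_neg (a b : ℕ) :
    kernelC (-a) (-b) =ᵐ[volume.restrict circ]
      fun h => -∑ p ∈ Finset.range a, ∑ q ∈ Finset.range b, expI (-(p : ℤ) + -q + -1) h := by
  refine kernelC_ae_eq fun h => ?_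
  simp only [expI_add, expI_neg_nat, ← Finset.mul_sum, ← Finset.sum_mul]
  rw [← geom_sum_mul (expI (-1) h) a, ← geom_sum_mul (expI (-1) h) b]
  linear_combination (∑ i ∈ Finset.range a, expI (-1) h ^ i) *
    (∑ i ∈ Finset.range b, expI (-1) h ^ i) *
    (expI (-1) h - 1) * (expI_one_mul_expI_neg_one h)

lemma kernelC_nat_neg (a b : ℕ) :
    kernelC a (-b) =ᵐ[volume.restrict circ]
      fun h => ∑ p ∈ Finset.range a, ∑ q ∈ Finset.range b, expI ((p : ℤ) + -q) h := by
  refine kernelC_ae_eq fun h => ?_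
  simp only [expI_add, expI_nat, expI_neg_nat, ← Finset.mul_sum, ← Finset.sum_mul]
  rw [← geom_sum_mul (expI 1 h) a, ← geom_sum_mul (expI (-1) h) b]
  ring

lemma kernelC_comm (j k : ℤ) : kernelC j k = kernelC k j := by
  funext h
  simp only [kernelC, mul_comm]

lemma Cjk_eq_integral (j k : ℤ) : Cjk j k = ∫ h in circ, kernelC j k h := rfl

lemma Cjk_comm (j k : ℤ) : Cjk j k = Cjk k j := by
  rw [Cjk_eq_integral, kernelC_comm, Cjk_eq_integral]

lemma integrableOn_kernelC (j k : ℤ) : IntegrableOn (kernelC j k) circ := by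
  obtain ⟨a, rfl | rfl⟩ := j.eq_nat_or_neg <;> obtain ⟨b, rfl | rfl⟩ := k.eq_nat_or_neg
  · exact (integrableOn_circ (by fun_prop)).congr (kernelC_nat_nat a b).symm
  · exact (integrableOn_circ (by fun_prop)).congr (kernelC_nat_neg a b).symm
  · rw [kernelC_comm]
    exact (integrableOn_circ (by fun_prop)).congr (kernelC_nat_neg b a).symm
  · exact (integrableOn_circ (by fun_prop)).congr (kernelC_neg_neg a b).symm

lemma integral_sum_sum_expI (s t : Finset ℕ) (m : ℕ → ℕ → ℤ) :
    ∫ h in circ, ∑ p ∈ s, ∑ q ∈ t, expI (m p q) h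
      = ∑ p ∈ s, ∑ q ∈ t, if m p q = 0 then 2 * (π : ℂ) else 0 := by
  rw [integral_finsetSum _ fun p _ => integrableOn_circ (by fun_prop)]
  refine Finset.sum_congr rfl fun p _ => ?_
  rw [integral_finsetSum _ fun q _ => integrableOn_circ (by fun_prop)]
  exact Finset.sum_congr rfl fun q _ => integral_expI _

lemma Cjk_nat_nat (a b : ℕ) : Cjk a b = 0 := by
  rw [Cjk_eq_integral, integral_congr_ae (kernelC_nat_nat a b), integral_neg,
    integral_sum_sum_expI _ _ fun p q => (p : ℤ) + q + 1, neg_eq_zero]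
  exact Finset.sum_eq_zero fun p _ => Finset.sum_eq_zero fun q _ => if_neg (by omega)

lemma Cjk_neg_neg (a b : ℕ) : Cjk (-a) (-b) = 0 := by
  rw [Cjk_eq_integral, integral_congr_ae (kernelC_neg_neg a b), integral_neg,
    integral_sum_sum_expI _ _ fun p q => -(p : ℤ) + -q + -1, neg_eq_zero]
  exact Finset.sum_eq_zero fun p _ => Finset.sum_eq_zero fun q _ => if_neg (by omega)

lemma Cjk_nat_neg (a b : ℕ) : Cjk a (-b) = (min a b : ℕ) * (2 * (π : ℂ)) := by
  rw [Cjk_eq_integral, integral_congr_ae (kernelC_nat_neg a b),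
    integral_sum_sum_expI _ _ fun p q => (p : ℤ) + -q]
  have : ∀ p q : ℕ, (p : ℤ) + -q = 0 ↔ p = q := by omega
  simp only [this, Finset.sum_ite_eq, Finset.mem_range]
  rw [← Finset.sum_filter, Finset.sum_const, nsmul_eq_mul]
  congr 2
  rw [show (Finset.range a).filter (· < b) = Finset.range (min a b) by ext; simp,
    Finset.card_range]

/-- `|j + k|^s |C(j,k)| ≤ 2π min(|j|,|k|) max(|j|,|k|)^s`. -/
lemma abs_rpow_mul_norm_Cjk_le {s : ℝ} (hs : 0 ≤ s) (j k : ℤ) :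
    |((j + k : ℤ) : ℝ)| ^ s * ‖Cjk j k‖
      ≤ 2 * π * (min |(j : ℝ)| |(k : ℝ)| * max |(j : ℝ)| |(k : ℝ)| ^ s) := by
  have key : ∀ a b : ℕ, |(((a : ℤ) + -(b : ℤ) : ℤ) : ℝ)| ^ s * ‖Cjk a (-b)‖
      ≤ 2 * π * (min |(((a : ℤ)) : ℝ)| |((-(b : ℤ) : ℤ) : ℝ)|
        * max |((a : ℤ) : ℝ)| |((-(b : ℤ) : ℤ) : ℝ)| ^ s) := by
    intro a b
    have hn : ‖Cjk a (-b)‖ = min (a : ℝ) b * (2 * π) := by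
      rw [Cjk_nat_neg]
      simp [abs_of_pos pi_pos]
    have hm : |(((a : ℤ) + -(b : ℤ) : ℤ) : ℝ)| ≤ max (a : ℝ) b := by
      push_cast
      rw [abs_le]
      constructor <;> rcases le_total (a : ℝ) b with h | h <;> simp [h] <;>
        linarith [Nat.cast_nonneg (α := ℝ) a, Nat.cast_nonneg (α := ℝ) b]
    have hp := Real.rpow_le_rpow (abs_nonneg _) hm hs
    rw [hn]
    push_cast
    push_cast at hp
    rw [abs_neg, Nat.abs_cast, Nat.abs_cast]
    have : 0 ≤ min (a : ℝ) b * (2 * π) := by positivity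
    nlinarith [mul_le_mul_of_nonneg_right hp this]
  have nonneg : 0 ≤ 2 * π * (min |(j : ℝ)| |(k : ℝ)| * max |(j : ℝ)| |(k : ℝ)| ^ s) := by
    positivity
  obtain ⟨a, rfl | rfl⟩ := j.eq_nat_or_neg <;> obtain ⟨b, rfl | rfl⟩ := k.eq_nat_or_neg
  · rwa [Cjk_nat_nat, norm_zero, mul_zero]
  · exact key a b
  · rw [Cjk_comm, add_comm, min_comm, max_comm]
    exact key b a
  · rwa [Cjk_neg_neg, norm_zero, mul_zero]

lemma fc_sum_expI {ι : Type*} (s : Finset ι) (c : ι → ℂ) (m : ι → ℤ) (n : ℤ) :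
    fc (fun x => ∑ i ∈ s, c i * expI (m i) x) n = ∑ i ∈ s, if m i = n then c i else 0 := by
  have h1 : ∀ x : ℝ, (∑ i ∈ s, c i * expI (m i) x)
      * Complex.exp (-(Complex.I * (n : ℂ) * (x : ℂ))) = ∑ i ∈ s, c i * expI (m i + -n) x := by
    intro x
    have : Complex.exp (-(Complex.I * (n : ℂ) * (x : ℂ))) = expI (-n) x := by
      rw [expI]
      push_cast
      ring_nf
    rw [this, Finset.sum_mul]
    exact Finset.sum_congr rfl fun i _ => by rw [expI_add, mul_assoc]
  simp only [fc, h1]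
  rw [integral_finsetSum _ fun i _ => integrableOn_circ (by fun_prop), Finset.mul_sum]
  refine Finset.sum_congr rfl fun i _ => ?_
  rw [integral_const_mul, integral_expI]
  simp only [← sub_eq_add_neg, sub_eq_zero]
  split_ifs
  · have : (π : ℂ) ≠ 0 := by exact_mod_cast pi_ne_zero
    push_cast
    field_simp
  · simp

lemma IsTrigPoly.exists_finset {u : ℝ → ℝ} (hu : IsTrigPoly u) :
    ∃ S : Finset ℤ, (∀ x : ℝ, (u x : ℂ) = ∑ k ∈ S, fcR u k * expI k x) ∧
      ∀ k ∉ S, fcR u k = 0 := by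
  obtain ⟨S, hS⟩ := hu
  refine ⟨S, hS, fun k hk => ?_⟩
  have h : (fun x => (u x : ℂ)) = fun x => ∑ k ∈ S, fcR u k * expI k x := funext hS
  rw [fcR, h, fc_sum_expI S _ fun i => i, Finset.sum_ite_eq', if_neg hk]

lemma kernelC_periodic (j k : ℤ) : Function.Periodic (kernelC j k) (2 * π) := by
  intro h
  have : Real.sin ((h + 2 * π) / 2) = -Real.sin (h / 2) := by
    rw [← Real.sin_add_pi]
    ring_nf
  simp only [kernelC, expI_periodic j h, expI_periodic k h, this, neg_sq]

lemma integral_circ_comp_sub {f : ℝ → ℂ} (hf : Function.Periodic f (2 * π)) (x : ℝ) :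
    ∫ y in circ, f (y - x) = ∫ y in circ, f y := by
  have hle : -π ≤ π := by linarith [pi_pos]
  simp only [circ]
  rw [← intervalIntegral.integral_of_le hle, ← intervalIntegral.integral_of_le hle,
    intervalIntegral.integral_comp_sub_right]
  have := hf.intervalIntegral_add_eq (-π - x) (-π)
  rwa [show -π - x + 2 * π = π - x by ring, show -π + 2 * π = π by ring] at this

lemma sub_mul_sub_div_cd_sq (j k : ℤ) (x y : ℝ) :
    (expI j x - expI j y) * (expI k x - expI k y) / ((cd x y ^ 2 : ℝ) : ℂ)
      = expI (j + k) x * kernelC j k (y - x) := by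
  have hc : cd x y ^ 2 = 4 * Real.sin ((y - x) / 2) ^ 2 := by
    rw [cd, mul_pow, sq_abs, show (x - y) / 2 = -((y - x) / 2) by ring, Real.sin_neg]
    ring
  have he : ∀ m : ℤ, expI m y = expI m x * expI m (y - x) := fun m => by
    rw [← expI_add_right, add_sub_cancel]
  rw [hc, kernelC, he j, he k, expI_add]
  ring

lemma d12prod_eq_sum {u v : ℝ → ℝ} {S T : Finset ℤ} {a b : ℤ → ℂ}
    (hu : ∀ x : ℝ, (u x : ℂ) = ∑ j ∈ S, a j * expI j x)
    (hv : ∀ x : ℝ, (v x : ℂ) = ∑ k ∈ T, b k * expI k x) (x : ℝ) :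
    d12prod u v x
      = ∑ p ∈ S ×ˢ T, a p.1 * b p.2 * Cjk p.1 p.2 * expI (p.1 + p.2) x := by
  have h1 : ∀ y : ℝ, (((u x - u y) * (v x - v y) / cd x y ^ 2 : ℝ) : ℂ)
      = ∑ p ∈ S ×ˢ T, a p.1 * b p.2 * expI (p.1 + p.2) x * kernelC p.1 p.2 (y - x) := by
    intro y
    rw [Complex.ofReal_div, Complex.ofReal_mul, Complex.ofReal_sub, Complex.ofReal_sub,
      hu, hu, hv, hv, ← Finset.sum_sub_distrib, ← Finset.sum_sub_distrib, Finset.sum_mul_sum,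
      ← Finset.sum_product', Finset.sum_div]
    refine Finset.sum_congr rfl fun p _ => ?_
    rw [mul_assoc _ (expI _ x), ← sub_mul_sub_div_cd_sq]
    ring
  rw [d12prod, ← integral_complex_ofReal]
  simp only [h1]
  rw [integral_circ_comp_sub
    (f := fun h => ∑ p ∈ S ×ˢ T, a p.1 * b p.2 * expI (p.1 + p.2) x * kernelC p.1 p.2 h)
    (fun h => by simp only [kernelC_periodic _ _ h]),
    integral_finsetSum _ fun p _ => (integrableOn_kernelC p.1 p.2).const_mul _]
  refine Finset.sum_congr rfl fun p _ => ?_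
  rw [integral_const_mul, ← Cjk_eq_integral]
  ring

lemma fc_d12prod {u v : ℝ → ℝ} {S T : Finset ℤ} {a b : ℤ → ℂ}
    (hu : ∀ x : ℝ, (u x : ℂ) = ∑ j ∈ S, a j * expI j x)
    (hv : ∀ x : ℝ, (v x : ℂ) = ∑ k ∈ T, b k * expI k x) (hS : ∀ j ∉ S, a j = 0) (n : ℤ) :
    fc (d12prod u v) n = ∑ k ∈ T, a (n - k) * b k * Cjk (n - k) k := by
  rw [funext (d12prod_eq_sum hu hv), fc_sum_expI, Finset.sum_product_right]
  refine Finset.sum_congr rfl fun k _ => ?_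
  simp only [← eq_sub_iff_add_eq]
  rw [Finset.sum_ite_eq']
  split_ifs with h
  · rfl
  · rw [hS _ h, zero_mul, zero_mul]

/-- Young's inequality `ℓ² * ℓ¹ ⊆ ℓ²` with a finitely supported second factor. -/
lemma sum_sq_sum_mul_le {A B : ℤ → ℝ} (hB : ∀ k, 0 ≤ B k) (hA : Summable fun j => A j ^ 2)
    (N T : Finset ℤ) :
    ∑ n ∈ N, (∑ k ∈ T, A (n - k) * B k) ^ 2 ≤ (∑ k ∈ T, B k) ^ 2 * ∑' j, A j ^ 2 := by
  have h1 : ∀ n, (∑ k ∈ T, A (n - k) * B k) ^ 2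
      ≤ (∑ k ∈ T, B k) * ∑ k ∈ T, B k * A (n - k) ^ 2 := fun n =>
    Finset.sum_sq_le_sum_mul_sum_of_sq_le_mul T (fun k _ => hB k)
      (fun k _ => mul_nonneg (hB k) (sq_nonneg _)) fun k _ => le_of_eq (by ring)
  have h2 : ∀ k, ∑ n ∈ N, A (n - k) ^ 2 ≤ ∑' j, A j ^ 2 := fun k => by
    rw [← (Equiv.subRight k).tsum_eq]
    exact ((Equiv.subRight k).summable_iff.2 hA).sum_le_tsum N fun _ _ => sq_nonneg _
  have h3 : 0 ≤ ∑ k ∈ T, B k := Finset.sum_nonneg fun k _ => hB k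
  calc ∑ n ∈ N, (∑ k ∈ T, A (n - k) * B k) ^ 2
      ≤ ∑ n ∈ N, (∑ k ∈ T, B k) * ∑ k ∈ T, B k * A (n - k) ^ 2 :=
        Finset.sum_le_sum fun n _ => h1 n
    _ = (∑ k ∈ T, B k) * ∑ k ∈ T, B k * ∑ n ∈ N, A (n - k) ^ 2 := by
        rw [← Finset.mul_sum, Finset.sum_comm]
        simp only [Finset.mul_sum]
    _ ≤ (∑ k ∈ T, B k) * ∑ k ∈ T, B k * ∑' j, A j ^ 2 := by
        gcongr with k
        · exact hB k
        · exact h2 k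
    _ = (∑ k ∈ T, B k) ^ 2 * ∑' j, A j ^ 2 := by
        rw [← Finset.sum_mul]
        ring

lemma sum_mul_comp_sub_comm {S T : Finset ℤ} {f g : ℤ → ℝ} (hf : ∀ j ∉ S, f j = 0)
    (hg : ∀ k ∉ T, g k = 0) (n : ℤ) :
    ∑ k ∈ T, f (n - k) * g k = ∑ j ∈ S, g (n - j) * f j := by
  have h1 : ∑' k, f (n - k) * g k = ∑ k ∈ T, f (n - k) * g k :=
    tsum_eq_sum fun k hk => by rw [hg k hk, mul_zero]
  have h2 : ∑' j, g (n - j) * f j = ∑ j ∈ S, g (n - j) * f j :=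
    tsum_eq_sum fun j hj => by rw [hf j hj, mul_zero]
  rw [← h1, ← h2, ← (Equiv.subLeft n).tsum_eq]
  exact tsum_congr fun k => by simp [mul_comm]

/-- The `ℓ¹` norm of `|k|^{q-1/2-ε} a_k` is controlled by the `ℓ²` norm of `|k|^q a_k`. -/
lemma sq_sum_rpow_mul_le {ε : ℝ} (hε : 0 < ε) {a : ℤ → ℝ} {T : Finset ℤ}
    (ha : ∀ k ∉ T, a k = 0) (q : ℝ) :
    (∑ k ∈ T, |(k : ℝ)| ^ (-(1 / 2 + ε)) * (|(k : ℝ)| ^ q * a k)) ^ 2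
      ≤ (∑' k : ℤ, |(k : ℝ)| ^ (-(1 + 2 * ε))) * ∑' k : ℤ, (|(k : ℝ)| ^ q * a k) ^ 2 := by
  have hs := Real.summable_abs_int_rpow (b := 1 + 2 * ε) (by linarith)
  have h2 : ∑' k : ℤ, (|(k : ℝ)| ^ q * a k) ^ 2 = ∑ k ∈ T, (|(k : ℝ)| ^ q * a k) ^ 2 :=
    tsum_eq_sum fun k hk => by rw [ha k hk]; simp
  have hsq : ∀ k : ℤ, (|(k : ℝ)| ^ (-(1 / 2 + ε))) ^ 2 = |(k : ℝ)| ^ (-(1 + 2 * ε)) := fun k => by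
    rw [← Real.rpow_mul_natCast (abs_nonneg _)]
    congr 1
    push_cast
    ring
  rw [h2]
  refine (Finset.sum_mul_sq_le_sq_mul_sq T _ _).trans ?_
  gcongr
  simp only [hsq]
  exact hs.sum_le_tsum T fun k _ => by positivity

/-- Pointwise distribution of derivatives: the low frequency carries a summable weight. -/
lemma min_mul_max_rpow_le {x y s ε : ℝ} (hx : 0 ≤ x) (hy : 0 ≤ y) (hε : 0 < ε) :
    min x y * max x y ^ s
      ≤ x ^ (1 / 2 + s + 4 * ε) * (y ^ (-(1 / 2 + 2 * ε)) * y ^ (1 - 2 * ε))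
        + x ^ (-(1 / 2 + 2 * ε)) * x ^ (1 - 2 * ε) * y ^ (1 / 2 + s + 4 * ε) := by
  have key : ∀ {x y : ℝ}, 0 ≤ y → y ≤ x →
      y * x ^ s ≤ x ^ (1 / 2 + s + 4 * ε) * (y ^ (-(1 / 2 + 2 * ε)) * y ^ (1 - 2 * ε)) := by
    intro x y hy hyx
    rcases hy.eq_or_lt with rfl | hy0
    · rw [zero_mul]
      positivity
    have hx0 : 0 < x := hy0.trans_le hyx
    have h1 : y = y ^ (1 / 2 + 4 * ε) * (y ^ (-(1 / 2 + 2 * ε)) * y ^ (1 - 2 * ε)) := by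
      rw [← Real.rpow_add hy0, ← Real.rpow_add hy0]
      ring_nf
      rw [Real.rpow_one]
    have h2 : x ^ (1 / 2 + s + 4 * ε) = x ^ (1 / 2 + 4 * ε) * x ^ s := by
      rw [← Real.rpow_add hx0]
      ring_nf
    have h3 : y ^ (1 / 2 + 4 * ε) ≤ x ^ (1 / 2 + 4 * ε) :=
      Real.rpow_le_rpow hy hyx (by positivity)
    calc y * x ^ s
        = y ^ (1 / 2 + 4 * ε) * (y ^ (-(1 / 2 + 2 * ε)) * y ^ (1 - 2 * ε)) * x ^ s := by
          rw [← h1]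
      _ ≤ x ^ (1 / 2 + 4 * ε) * (y ^ (-(1 / 2 + 2 * ε)) * y ^ (1 - 2 * ε)) * x ^ s := by
          gcongr
      _ = _ := by
          rw [h2]
          ring
  rcases le_total y x with h | h
  · rw [min_eq_right h, max_eq_left h]
    exact le_add_of_le_of_nonneg (key hy h) (by positivity)
  · rw [min_eq_left h, max_eq_right h]
    refine le_add_of_nonneg_of_le (by positivity) ((key hx h).trans (le_of_eq (mul_comm _ _)))

lemma abs_rpow_mul_sq (j : ℤ) (r c : ℝ) :
    (|(j : ℝ)| ^ r * c) ^ 2 = |(j : ℝ)| ^ (2 * r) * c ^ 2 := by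
  rw [mul_pow, ← Real.rpow_mul_natCast (abs_nonneg _)]
  congr 2
  push_cast
  ring

/-- Discrete form of the product estimate: `f` is the high-frequency and `g` the
low-frequency factor. -/
lemma sum_sq_weighted_conv_le {f g : ℤ → ℝ} {S T : Finset ℤ} {ε : ℝ} (hε : 0 < ε)
    (hf : ∀ j ∉ S, f j = 0) (hg : ∀ k ∉ T, g k = 0) (hg0 : ∀ k, 0 ≤ g k) (p q : ℝ)
    (N : Finset ℤ) :
    ∑ n ∈ N, (∑ k ∈ T, (|((n - k : ℤ) : ℝ)| ^ p * f (n - k))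
        * (|(k : ℝ)| ^ (-(1 / 2 + ε)) * (|(k : ℝ)| ^ q * g k))) ^ 2
      ≤ (∑' k : ℤ, |(k : ℝ)| ^ (-(1 + 2 * ε)))
        * ((∑' j : ℤ, |(j : ℝ)| ^ (2 * p) * f j ^ 2)
          * ∑' k : ℤ, |(k : ℝ)| ^ (2 * q) * g k ^ 2) := by
  have hA : Summable fun j : ℤ => (|(j : ℝ)| ^ p * f j) ^ 2 :=
    summable_of_ne_finset_zero (s := S) fun j hj => by rw [hf j hj]; simp
  have h1 := sum_sq_sum_mul_le (A := fun j : ℤ => |(j : ℝ)| ^ p * f j)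
    (B := fun k : ℤ => |(k : ℝ)| ^ (-(1 / 2 + ε)) * (|(k : ℝ)| ^ q * g k))
    (fun k => by have := hg0 k; positivity) hA N T
  refine h1.trans ((mul_le_mul_of_nonneg_right (sq_sum_rpow_mul_le hε hg q)
    (tsum_nonneg fun j : ℤ => sq_nonneg (|(j : ℝ)| ^ p * f j))).trans (le_of_eq ?_))
  simp only [abs_rpow_mul_sq]
  ring

/-- The `Ḣ^s` estimate
`‖d_{1/2}u·d_{1/2}v‖_{Ḣ^s} ≲ ‖(-Δ)^{1/4+s/2+2ε}u‖_{L²}‖(-Δ)^{1/2-ε}v‖_{L²}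
 + ‖(-Δ)^{1/2-ε}u‖_{L²}‖(-Δ)^{1/4+s/2+2ε}v‖_{L²}` for trigonometric polynomials. -/
theorem d12prod_sobolev_estimate' (s ε : ℝ) (hs : 0 < s) (hε : 0 < ε) :
    ∃ C : ℝ, 0 < C ∧
      ∀ u v : ℝ → ℝ, IsTrigPoly u → IsTrigPoly v →
        (∑' n : ℤ, |(n : ℝ)| ^ (2 * s) * ‖fc (d12prod u v) n‖ ^ 2)
          ≤ C * ((∑' j : ℤ, |(j : ℝ)| ^ (1 + 2 * s + 8 * ε) * ‖fcR u j‖ ^ 2)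
                  * (∑' j : ℤ, |(j : ℝ)| ^ ((2 : ℝ) - 4 * ε) * ‖fcR v j‖ ^ 2)
              + (∑' j : ℤ, |(j : ℝ)| ^ ((2 : ℝ) - 4 * ε) * ‖fcR u j‖ ^ 2)
                  * (∑' j : ℤ, |(j : ℝ)| ^ (1 + 2 * s + 8 * ε) * ‖fcR v j‖ ^ 2)) := by
  have hK : 0 ≤ ∑' k : ℤ, |(k : ℝ)| ^ (-(1 + 2 * (2 * ε))) := tsum_nonneg fun k => by positivity
  set K := ∑' k : ℤ, |(k : ℝ)| ^ (-(1 + 2 * (2 * ε)))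
  refine ⟨(2 * π) ^ 2 * 2 * (K + 1), by positivity, fun u v hu hv => ?_⟩
  obtain ⟨S, hu, hS⟩ := hu.exists_finset
  obtain ⟨T, hv, hT⟩ := hv.exists_finset
  set a : ℤ → ℝ := fun j => ‖fcR u j‖ with ha
  set b : ℤ → ℝ := fun k => ‖fcR v k‖ with hb
  have haS : ∀ j ∉ S, a j = 0 := fun j hj => by simp [ha, hS j hj]
  have hbT : ∀ k ∉ T, b k = 0 := fun k hk => by simp [hb, hT k hk]
  set p := 1 / 2 + s + 4 * ε with hp
  set q := 1 - 2 * ε with hq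
  set X : ℤ → ℝ := fun n => ∑ k ∈ T, (|((n - k : ℤ) : ℝ)| ^ p * a (n - k))
    * (|(k : ℝ)| ^ (-(1 / 2 + 2 * ε)) * (|(k : ℝ)| ^ q * b k)) with hX
  set Y : ℤ → ℝ := fun n => ∑ j ∈ S, (|((n - j : ℤ) : ℝ)| ^ p * b (n - j))
    * (|(j : ℝ)| ^ (-(1 / 2 + 2 * ε)) * (|(j : ℝ)| ^ q * a j))
  have hpoint : ∀ n : ℤ, |(n : ℝ)| ^ s * ‖fc (d12prod u v) n‖ ≤ 2 * π * (X n + Y n) := by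
    intro n
    have hcomm : Y n = ∑ k ∈ T, (|((n - k : ℤ) : ℝ)| ^ (-(1 / 2 + 2 * ε))
        * (|((n - k : ℤ) : ℝ)| ^ q * a (n - k))) * (|(k : ℝ)| ^ p * b k) :=
      (sum_mul_comp_sub_comm
        (f := fun j : ℤ => |(j : ℝ)| ^ (-(1 / 2 + 2 * ε)) * (|(j : ℝ)| ^ q * a j))
        (g := fun k : ℤ => |(k : ℝ)| ^ p * b k)
        (fun j hj => by simp [haS j hj]) (fun k hk => by simp [hbT k hk]) n).symm
    rw [fc_d12prod hu hv hS, hcomm, hX, ← Finset.sum_add_distrib, Finset.mul_sum]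
    refine (mul_le_mul_of_nonneg_left (norm_sum_le _ _) (by positivity)).trans ?_
    rw [Finset.mul_sum]
    refine Finset.sum_le_sum fun k _ => ?_
    have h1 := abs_rpow_mul_norm_Cjk_le hs.le (n - k) k
    rw [sub_add_cancel] at h1
    have h2 := min_mul_max_rpow_le (s := s) (abs_nonneg ((n - k : ℤ) : ℝ)) (abs_nonneg (k : ℝ)) hε
    have h3 := h1.trans (mul_le_mul_of_nonneg_left h2 two_pi_pos.le)
    have h4 := mul_le_mul_of_nonneg_left h3
      (mul_nonneg (norm_nonneg (fcR u (n - k))) (norm_nonneg (fcR v k)))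
    rw [norm_mul, norm_mul]
    refine (le_of_eq ?_).trans (h4.trans (le_of_eq ?_)) <;> ring
  have hsq : ∀ n : ℤ, |(n : ℝ)| ^ (2 * s) * ‖fc (d12prod u v) n‖ ^ 2
      ≤ (2 * π) ^ 2 * 2 * (X n ^ 2 + Y n ^ 2) := by
    intro n
    rw [← abs_rpow_mul_sq]
    calc (|(n : ℝ)| ^ s * ‖fc (d12prod u v) n‖) ^ 2 ≤ (2 * π * (X n + Y n)) ^ 2 :=
          pow_le_pow_left₀ (by positivity) (hpoint n) 2
      _ = (2 * π) ^ 2 * (X n + Y n) ^ 2 := by ring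
      _ ≤ (2 * π) ^ 2 * (2 * (X n ^ 2 + Y n ^ 2)) := by
          gcongr
          exact add_sq_le
      _ = (2 * π) ^ 2 * 2 * (X n ^ 2 + Y n ^ 2) := by ring
  rw [show 1 + 2 * s + 8 * ε = 2 * p by rw [hp]; ring, show 2 - 4 * ε = 2 * q by rw [hq]; ring]
  refine Real.tsum_le_of_sum_le (fun n => by positivity) fun N => ?_
  have hXs := sum_sq_weighted_conv_le (ε := 2 * ε) (by positivity) haS hbT
    (fun _ => norm_nonneg _) p q N
  have hYs := sum_sq_weighted_conv_le (ε := 2 * ε) (by positivity) hbT haS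
    (fun _ => norm_nonneg _) p q N
  set A₁ := ∑' j : ℤ, |(j : ℝ)| ^ (2 * p) * a j ^ 2
  set A₂ := ∑' j : ℤ, |(j : ℝ)| ^ (2 * q) * a j ^ 2
  set B₁ := ∑' j : ℤ, |(j : ℝ)| ^ (2 * p) * b j ^ 2
  set B₂ := ∑' j : ℤ, |(j : ℝ)| ^ (2 * q) * b j ^ 2
  have hnn : 0 ≤ A₁ * B₂ + A₂ * B₁ := by
    have h : ∀ (c : ℤ → ℝ) (r : ℝ), 0 ≤ ∑' j : ℤ, |(j : ℝ)| ^ r * c j ^ 2 := fun c r =>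
      tsum_nonneg fun j => by positivity
    exact add_nonneg (mul_nonneg (h _ _) (h _ _)) (mul_nonneg (h _ _) (h _ _))
  calc ∑ n ∈ N, |(n : ℝ)| ^ (2 * s) * ‖fc (d12prod u v) n‖ ^ 2
      ≤ ∑ n ∈ N, (2 * π) ^ 2 * 2 * (X n ^ 2 + Y n ^ 2) := Finset.sum_le_sum fun n _ => hsq n
    _ = (2 * π) ^ 2 * 2 * (∑ n ∈ N, X n ^ 2 + ∑ n ∈ N, Y n ^ 2) := by
        rw [← Finset.mul_sum, Finset.sum_add_distrib]
    _ ≤ (2 * π) ^ 2 * 2 * (K * (A₁ * B₂) + K * (B₁ * A₂)) := by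
        gcongr
    _ = (2 * π) ^ 2 * 2 * K * (A₁ * B₂ + A₂ * B₁) := by ring
    _ ≤ (2 * π) ^ 2 * 2 * (K + 1) * (A₁ * B₂ + A₂ * B₁) := by
        gcongr
        linarith
end
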